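/- arXiv:2403.10372 — 12 statements merged into one kernel-verified Lean document; each statement's English description precedes it below -/
import Mathlib

section
/- Let F be a finite field and let M be an n×n matrix over F all of whose entries are nonzero (n ≥ 1). If (D₁, M₁, D₂) and (D₁′, M₁′, D₂′) are two triples such that D₁, D₁′ are diagonal with nonzero diagonal entries, D₂, D₂′ are diagonal with nonzero diagonal entries and first diagonal entry equal to 1, M₁, M₁′ are representative matrices, and M = D₁·M₁·D₂ = D₁′·M₁′·D₂′, then D₁ = D₁′, D₂ = D₂′, and M₁ = M₁′. -/
theorem diagonal_representative_decomposition_unique {F : Type*} [Field F] [Fintype F]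
    {n : ℕ} (hn : 1 ≤ n) (M : Matrix (Fin n) (Fin n) F)
    (hM : ∀ i j, M i j ≠ 0)
    (d₁ d₂ d₁' d₂' : Fin n → F)
    (M₁ M₁' : Matrix (Fin n) (Fin n) F)
    (hd₁ : ∀ i, d₁ i ≠ 0) (hd₂ : ∀ i, d₂ i ≠ 0) (hd₂0 : d₂ ⟨0, hn⟩ = 1)
    (hd₁' : ∀ i, d₁' i ≠ 0) (hd₂' : ∀ i, d₂' i ≠ 0) (hd₂0' : d₂' ⟨0, hn⟩ = 1)
    (hM₁ne : ∀ i j, M₁ i j ≠ 0) (hM₁row : ∀ j, M₁ ⟨0, hn⟩ j = 1)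
    (hM₁col : ∀ i, M₁ i ⟨0, hn⟩ = 1)
    (hM₁ne' : ∀ i j, M₁' i j ≠ 0) (hM₁row' : ∀ j, M₁' ⟨0, hn⟩ j = 1)
    (hM₁col' : ∀ i, M₁' i ⟨0, hn⟩ = 1)
    (hdec : M = Matrix.diagonal d₁ * M₁ * Matrix.diagonal d₂)
    (hdec' : M = Matrix.diagonal d₁' * M₁' * Matrix.diagonal d₂') :
    d₁ = d₁' ∧ d₂ = d₂' ∧ M₁ = M₁' := by
  have key : ∀ i j, d₁ i * M₁ i j * d₂ j = d₁' i * M₁' i j * d₂' j := fun i j => by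
    simpa [Matrix.mul_diagonal, Matrix.diagonal_mul] using
      congrFun (congrFun (hdec.symm.trans hdec') i) j
  have h₁ : d₁ = d₁' := funext fun i => by
    simpa [hM₁col, hM₁col', hd₂0, hd₂0'] using key i ⟨0, hn⟩
  subst h₁
  have h₂ : d₂ = d₂' := funext fun j => by
    simpa [hM₁row, hM₁row', hd₁] using key ⟨0, hn⟩ j
  subst h₂
  refine ⟨rfl, rfl, Matrix.ext fun i j => ?_⟩
  exact mul_left_cancel₀ (hd₁ i) (mul_right_cancel₀ (hd₂ j) (key i j))
end

section
/- Let F be a field, let M₁ = (c_{i,j}) be an invertible n×n representative matrix over F with inverse M₂ = (d_{i,j}), let D₁ = Diag(λ₁,…,λₙ) and D₂ = Diag(1,θ₂,…,θₙ) be diagonal matrices with all diagonal entries nonzero (where θ₁ = 1). If the matrix M = D₁·M₁·D₂ is involutory (M² = I), then there exist nonzero elements α₁,…,αₙ ∈ F such that α_i = λ_i·θ_i for every i and d_{i,j} = α_i·α_j·c_{i,j} for all 1 ≤ i,j ≤ n. -/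
theorem involutory_implies_inverse_entries_proportional {F : Type*} [Field F]
    {n : ℕ} (hn : 0 < n)
    (M₁ M₂ : Matrix (Fin n) (Fin n) F)
    (hrow : ∀ j, M₁ ⟨0, hn⟩ j = 1) (hcol : ∀ i, M₁ i ⟨0, hn⟩ = 1)
    (hne : ∀ i j, M₁ i j ≠ 0)
    (hinv : M₁ * M₂ = 1) (hinv' : M₂ * M₁ = 1)
    (lam θ : Fin n → F) (hlam : ∀ i, lam i ≠ 0) (hθ : ∀ i, θ i ≠ 0)
    (hθ0 : θ ⟨0, hn⟩ = 1)
    (hM : (Matrix.diagonal lam * M₁ * Matrix.diagonal θ) *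
          (Matrix.diagonal lam * M₁ * Matrix.diagonal θ) = 1) :
    ∃ α : Fin n → F, (∀ i, α i ≠ 0) ∧ (∀ i, α i = lam i * θ i) ∧
      (∀ i j, M₂ i j = α i * α j * M₁ i j) := by
  refine ⟨fun i => lam i * θ i, fun i => mul_ne_zero (hlam i) (hθ i), fun _ => rfl, ?_⟩
  have hcomm : M₁ * (Matrix.diagonal θ * Matrix.diagonal lam * M₁ *
      (Matrix.diagonal θ * Matrix.diagonal lam)) = 1 := by
    simp only [Matrix.mul_assoc] at hM
    rw [mul_eq_one_comm] at hM
    simpa only [Matrix.mul_assoc] using hM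
  have hM₂ : M₂ = Matrix.diagonal θ * Matrix.diagonal lam * M₁ *
      (Matrix.diagonal θ * Matrix.diagonal lam) :=
    left_inv_eq_right_inv hinv' hcomm
  intro i j
  rw [hM₂, Matrix.diagonal_mul_diagonal, Matrix.mul_diagonal, Matrix.diagonal_mul]
  ring
end

section
/- Let F be a field, let M₁ = (c_{i,j}) be an invertible n×n representative matrix over F with inverse M₂ = (d_{i,j}), and suppose there exist nonzero elements α₁,…,αₙ ∈ F such that d_{i,j} = α_i·α_j·c_{i,j} for all 1 ≤ i,j ≤ n. Then for any nonzero λ₂,…,λₙ ∈ F, setting D₁ = Diag(α₁, λ₂, λ₃, …, λₙ) and D₂ = Diag(1, α₂/λ₂, α₃/λ₃, …, αₙ/λₙ), the matrix M = D₁·M₁·D₂ is involutory, i.e., M² = I. -/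
theorem involutory_of_inverse_entries_proportional {F : Type*} [Field F]
    {n : ℕ} (hn : 0 < n)
    (M₁ M₂ : Matrix (Fin n) (Fin n) F)
    (hrow : ∀ j, M₁ ⟨0, hn⟩ j = 1) (hcol : ∀ i, M₁ i ⟨0, hn⟩ = 1)
    (hne : ∀ i j, M₁ i j ≠ 0)
    (hinv : M₁ * M₂ = 1) (hinv' : M₂ * M₁ = 1)
    (α : Fin n → F) (hα : ∀ i, α i ≠ 0)
    (hd : ∀ i j, M₂ i j = α i * α j * M₁ i j)
    (lam : Fin n → F) (hlam : ∀ i, lam i ≠ 0)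
    (d₁ d₂ : Fin n → F)
    (hd₁ : d₁ = fun i => if i = ⟨0, hn⟩ then α ⟨0, hn⟩ else lam i)
    (hd₂ : d₂ = fun i => if i = ⟨0, hn⟩ then 1 else α i / lam i) :
    (Matrix.diagonal d₁ * M₁ * Matrix.diagonal d₂) *
      (Matrix.diagonal d₁ * M₁ * Matrix.diagonal d₂) = 1 := by
  have h₁ : ∀ i, d₁ i ≠ 0 := by
    intro i
    simp only [hd₁]
    split_ifs
    exacts [hα _, hlam i]
  have h₂ : ∀ i, d₂ i = α i * (d₁ i)⁻¹ := by
    intro i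
    simp only [hd₁, hd₂]
    split_ifs with h
    · rw [h, mul_inv_cancel₀ (hα _)]
    · rw [div_eq_mul_inv]
  have hM₂ : M₂ = Matrix.diagonal α * M₁ * Matrix.diagonal α := by
    ext i j
    rw [Matrix.mul_diagonal, Matrix.diagonal_mul, hd]
    ring
  have hD₂ : Matrix.diagonal d₂ = Matrix.diagonal α * Matrix.diagonal fun i => (d₁ i)⁻¹ := by
    rw [Matrix.diagonal_mul_diagonal, funext h₂]
  have hD₂D₁ : Matrix.diagonal d₂ * Matrix.diagonal d₁ = Matrix.diagonal α := by
    rw [Matrix.diagonal_mul_diagonal]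
    congr 1
    funext i
    rw [h₂, inv_mul_cancel_right₀ (h₁ i)]
  calc
    _ = Matrix.diagonal d₁ * (M₁ * ((Matrix.diagonal d₂ * Matrix.diagonal d₁) * M₁)) *
        Matrix.diagonal d₂ := by simp only [Matrix.mul_assoc]
    _ = Matrix.diagonal d₁ * (M₁ * M₂) * Matrix.diagonal fun i => (d₁ i)⁻¹ := by
      rw [hD₂D₁, hD₂, hM₂]
      simp only [Matrix.mul_assoc]
    _ = 1 := by
      rw [hinv, Matrix.mul_one, Matrix.diagonal_mul_diagonal]
      simp [h₁]
end

section
/- Let F be a field, let M₁ = (c_{i,j}) be an invertible n×n representative matrix over F with inverse M₂ = (d_{i,j}), let D₁ and D₂ be diagonal matrices with nonzero diagonal entries, where the first diagonal entry of D₂ equals 1, and suppose M = D₁·M₁·D₂ is involutory. Then for every i (1 ≤ i ≤ n), the element d_{i,i}/c_{i,i} is a quadratic residue in F, i.e., there exists a nonzero s ∈ F with d_{i,i} = s²·c_{i,i}; in particular, d_{1,1} is a square of a nonzero element of F. -/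
theorem involutory_implies_diag_ratio_quadratic_residue {F : Type*} [Field F]
    {n : ℕ} (hn : 0 < n)
    (M₁ M₂ : Matrix (Fin n) (Fin n) F)
    (hrow : ∀ j, M₁ ⟨0, hn⟩ j = 1) (hcol : ∀ i, M₁ i ⟨0, hn⟩ = 1)
    (hne : ∀ i j, M₁ i j ≠ 0)
    (hinv : M₁ * M₂ = 1) (hinv' : M₂ * M₁ = 1)
    (lam θ : Fin n → F) (hlam : ∀ i, lam i ≠ 0) (hθ : ∀ i, θ i ≠ 0)
    (hθ0 : θ ⟨0, hn⟩ = 1)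
    (hM : (Matrix.diagonal lam * M₁ * Matrix.diagonal θ) *
          (Matrix.diagonal lam * M₁ * Matrix.diagonal θ) = 1) :
    (∀ i, ∃ s : F, s ≠ 0 ∧ M₂ i i = s ^ 2 * M₁ i i) ∧
      (∃ s : F, s ≠ 0 ∧ M₂ ⟨0, hn⟩ ⟨0, hn⟩ = s ^ 2) := by
  have hX : M₁ * (Matrix.diagonal θ * Matrix.diagonal lam * M₁ *
      (Matrix.diagonal θ * Matrix.diagonal lam)) = 1 := by
    have h : Matrix.diagonal lam * (M₁ * Matrix.diagonal θ * Matrix.diagonal lam * M₁ *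
        Matrix.diagonal θ) = 1 := by
      simpa only [Matrix.mul_assoc] using hM
    simpa only [Matrix.mul_assoc] using mul_eq_one_comm.mp h
  have hM₂ := left_inv_eq_right_inv hinv' hX
  have hdiag : ∀ i, M₂ i i = (θ i * lam i) ^ 2 * M₁ i i := fun i => by
    rw [hM₂, Matrix.diagonal_mul_diagonal, Matrix.mul_diagonal, Matrix.diagonal_mul]
    ring
  have hs : ∀ i, θ i * lam i ≠ 0 := fun i => mul_ne_zero (hθ i) (hlam i)
  exact ⟨fun i => ⟨_, hs i, hdiag i⟩, _, hs _, by rw [hdiag, hrow, mul_one]⟩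
end

section
/- Let F be a field, let M₁ = (c_{i,j}) be an invertible n×n representative matrix over F with inverse M₂ = (d_{i,j}), let D₁ and D₂ be diagonal matrices with nonzero diagonal entries, where the first diagonal entry of D₂ equals 1, and suppose M = D₁·M₁·D₂ is involutory. Then d_{i,j}·c_{j,i} = d_{j,i}·c_{i,j} for all 1 ≤ i,j ≤ n; in particular, d_{i,1} = d_{1,i} for all i = 1,…,n. -/
theorem involutory_implies_inverse_entries_symmetric_ratio {F : Type*} [Field F]
    {n : ℕ} (hn : 0 < n)
    (M₁ M₂ : Matrix (Fin n) (Fin n) F)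
    (hrow : ∀ j, M₁ ⟨0, hn⟩ j = 1) (hcol : ∀ i, M₁ i ⟨0, hn⟩ = 1)
    (hne : ∀ i j, M₁ i j ≠ 0)
    (hinv : M₁ * M₂ = 1) (hinv' : M₂ * M₁ = 1)
    (lam θ : Fin n → F) (hlam : ∀ i, lam i ≠ 0) (hθ : ∀ i, θ i ≠ 0)
    (hθ0 : θ ⟨0, hn⟩ = 1)
    (hM : (Matrix.diagonal lam * M₁ * Matrix.diagonal θ) *
          (Matrix.diagonal lam * M₁ * Matrix.diagonal θ) = 1) :
    (∀ i j, M₂ i j * M₁ j i = M₂ j i * M₁ i j) ∧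
      (∀ i, M₂ i ⟨0, hn⟩ = M₂ ⟨0, hn⟩ i) := by
  have hright : M₁ * (Matrix.diagonal θ * Matrix.diagonal lam * M₁ *
      (Matrix.diagonal θ * Matrix.diagonal lam)) = 1 := by
    have h : Matrix.diagonal lam * (M₁ * Matrix.diagonal θ * Matrix.diagonal lam * M₁ *
        Matrix.diagonal θ) = 1 := by
      simpa only [Matrix.mul_assoc] using hM
    simpa only [Matrix.mul_assoc] using mul_eq_one_comm.mp h
  have hM₂ := left_inv_eq_right_inv hinv' hright
  have hentry : ∀ i j, M₂ i j = θ i * lam i * M₁ i j * (θ j * lam j) := by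
    intro i j
    rw [hM₂, Matrix.diagonal_mul_diagonal, Matrix.mul_diagonal, Matrix.diagonal_mul]
  have hsymm : ∀ i j, M₂ i j * M₁ j i = M₂ j i * M₁ i j := by
    intro i j
    rw [hentry i j, hentry j i]
    ring
  exact ⟨hsymm, fun i => by simpa [hrow, hcol] using hsymm i ⟨0, hn⟩⟩
end

section
/- Let F be a field, n ≥ 2, and let M₁ be an n×n representative matrix over F whose lower-right (n−1)×(n−1) block is R (i.e., R_{i,j} = (M₁)_{i+1,j+1}). If M₁ is an MDS matrix, then R is an MDS matrix, no entry of R equals 1, any two distinct entries in the same row of R are different, and any two distinct entries in the same column of R are different. -/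
/-- A square matrix over a field is MDS if every square submatrix
(selected via injective row and column index maps, of any order `k ≥ 1`)
is nonsingular. -/
def IsMDS {F : Type*} [Field F] {n : ℕ} (M : Matrix (Fin n) (Fin n) F) : Prop :=
  ∀ (k : ℕ), 1 ≤ k → ∀ (f g : Fin k → Fin n), Function.Injective f → Function.Injective g →
    (M.submatrix f g).det ≠ 0

/-- The `2 × 2` minors of an MDS matrix do not vanish. -/
theorem IsMDS.mul_sub_mul_ne_zero {F : Type*} [Field F] {n : ℕ}
    {M : Matrix (Fin n) (Fin n) F} (h : IsMDS M) {i i' j j' : Fin n}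
    (hi : i ≠ i') (hj : j ≠ j') : M i j * M i' j' - M i j' * M i' j ≠ 0 := by
  have injective_pair : ∀ {a b : Fin n}, a ≠ b → Function.Injective ![a, b] := by
    intro a b hab x y hxy
    fin_cases x <;> fin_cases y <;> simp_all
  have hdet := h 2 one_le_two ![i, i'] ![j, j'] (injective_pair hi) (injective_pair hj)
  rwa [Matrix.det_fin_two] at hdet

/-- A square submatrix of an MDS matrix is MDS. -/
theorem IsMDS.submatrix {F : Type*} [Field F] {m n : ℕ}
    {M : Matrix (Fin n) (Fin n) F} (h : IsMDS M) {r c : Fin m → Fin n}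
    (hr : Function.Injective r) (hc : Function.Injective c) : IsMDS (M.submatrix r c) := by
  intro k hk f g hf hg
  rw [Matrix.submatrix_submatrix]
  exact h k hk _ _ (hr.comp hf) (hc.comp hg)

theorem mds_representative_necessary_conditions {F : Type*} [Field F]
    {m : ℕ} (hm : 1 ≤ m)
    (M₁ : Matrix (Fin (m + 1)) (Fin (m + 1)) F)
    (hrow : ∀ j, M₁ 0 j = 1) (hcol : ∀ i, M₁ i 0 = 1)
    (hne : ∀ i j, M₁ i j ≠ 0)
    (R : Matrix (Fin m) (Fin m) F)
    (hR : ∀ i j, R i j = M₁ i.succ j.succ)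
    (hMDS : IsMDS M₁) :
    IsMDS R ∧
      (∀ i j, R i j ≠ 1) ∧
      (∀ i j j', j ≠ j' → R i j ≠ R i j') ∧
      (∀ i i' j, i ≠ i' → R i j ≠ R i' j) := by
  obtain rfl : R = M₁.submatrix Fin.succ Fin.succ := Matrix.ext hR
  refine ⟨hMDS.submatrix (Fin.succ_injective m) (Fin.succ_injective m), fun i j h => ?_,
    fun i j j' hj h => ?_, fun i i' j hi h => ?_⟩ <;> rw [Matrix.submatrix_apply] at h
  · apply hMDS.mul_sub_mul_ne_zero (Fin.succ_ne_zero i).symm (Fin.succ_ne_zero j).symm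
    simp [hrow, hcol, h]
  · apply hMDS.mul_sub_mul_ne_zero (Fin.succ_ne_zero i).symm ((Fin.succ_injective m).ne hj)
    simp [hrow, h]
  · apply hMDS.mul_sub_mul_ne_zero ((Fin.succ_injective m).ne hi) (Fin.succ_ne_zero j).symm
    simp [hcol, h]
end

section
/- Let F be a field, n ≥ 2, and let M₁ be an n×n representative matrix over F whose lower-right (n−1)×(n−1) block is R, and let U denote the (n−1)×(n−1) matrix all of whose entries equal 1. If M₁ is an MDS matrix, then the matrix R − U is nonsingular. -/
/-- Subtracting the first row from the others in a matrix whose first row and column are all ones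
does not change the determinant, and leaves a single nonzero entry in the first column. -/
theorem Matrix.det_eq_det_succ_succ_sub_one {F : Type*} [CommRing F] {m : ℕ}
    (M : Matrix (Fin (m + 1)) (Fin (m + 1)) F)
    (hrow : ∀ j, M 0 j = 1) (hcol : ∀ i, M i 0 = 1) :
    M.det = (Matrix.of fun i j : Fin m => M i.succ j.succ - 1).det := by
  have hdet := Matrix.det_eq_of_forall_row_eq_smul_add_const
    (A := Matrix.of fun i j => M i j + (if i = 0 then 0 else -1) * M 0 j) (B := M)
    (fun i => if i = 0 then 0 else -1) 0 (if_pos rfl) fun _ _ => rfl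
  rw [← hdet, Matrix.det_succ_column_zero, Fin.sum_univ_succ, Finset.sum_eq_zero]
  · simp only [Matrix.of_apply, hrow]
    simp only [Fin.val_zero, pow_zero, one_mul, if_true, mul_one, add_zero]
    congr 1
    ext i j
    simp [Fin.succ_ne_zero, sub_eq_add_neg]
  · intro i _
    simp [hcol, Fin.succ_ne_zero]

theorem mds_representative_sub_allones_nonsingular {F : Type*} [Field F]
    {m : ℕ} (hm : 1 ≤ m)
    (M₁ : Matrix (Fin (m + 1)) (Fin (m + 1)) F)
    (hrow : ∀ j, M₁ 0 j = 1) (hcol : ∀ i, M₁ i 0 = 1)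
    (hne : ∀ i j, M₁ i j ≠ 0)
    (R : Matrix (Fin m) (Fin m) F)
    (hR : ∀ i j, R i j = M₁ i.succ j.succ)
    (U : Matrix (Fin m) (Fin m) F)
    (hU : ∀ i j, U i j = 1)
    (hMDS : IsMDS M₁) :
    (R - U).det ≠ 0 := by
  have hsub : R - U = Matrix.of fun i j => M₁ i.succ j.succ - 1 := by
    ext i j
    simp [hR, hU]
  rw [hsub, ← M₁.det_eq_det_succ_succ_sub_one hrow hcol]
  exact hMDS (m + 1) (Nat.le_add_left 1 m) id id Function.injective_id Function.injective_id
end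

section
/- Let F be a finite field of characteristic 2 and let a, b, c, d ∈ F. The 3×3 matrix M₁ with rows (1,1,1), (1,a,b), (1,c,d) is MDS if and only if: a, b, c, d ∉ {0, 1}; b ≠ a; c ≠ a; d ≠ b; d ≠ c; a·d ≠ b·c; and (a+1)·(d+1) ≠ (b+1)·(c+1). -/
/-- A `3 × 3` matrix is MDS if and only if its entries, its `2 × 2` minors and its determinant
are all nonzero. -/
theorem isMDS_fin_three_iff {F : Type*} [Field F] (M : Matrix (Fin 3) (Fin 3) F) :
    IsMDS M ↔ (∀ i j, M i j ≠ 0) ∧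
      (∀ i i' j j', i < i' → j < j' → M i j * M i' j' - M i j' * M i' j ≠ 0) ∧ M.det ≠ 0 := by
  constructor
  · intro h
    refine ⟨fun i j => ?_, fun i i' j j' hi hj => ?_, ?_⟩
    · simpa using h 1 le_rfl (fun _ => i) (fun _ => j)
        (Function.injective_of_subsingleton _) (Function.injective_of_subsingleton _)
    · have hinj {x y : Fin 3} (hxy : x < y) : Function.Injective ![x, y] := by
        simpa [Function.Injective, Fin.forall_fin_two] using ⟨hxy.ne, hxy.ne'⟩
      have hdet := h 2 one_le_two ![i, i'] ![j, j'] (hinj hi) (hinj hj)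
      rw [Matrix.det_fin_two] at hdet
      exact hdet
    · simpa using h 3 (by norm_num) id id Function.injective_id Function.injective_id
  · rintro ⟨h1, h2, h3⟩ k hk f g hf hg
    have hk3 : k ≤ 3 := by simpa using Fintype.card_le_of_injective f hf
    interval_cases k
    · simpa using h1 (f 0) (g 0)
    · rw [Matrix.det_fin_two]
      have hf01 : f 0 ≠ f 1 := hf.ne (by decide)
      have hg01 : g 0 ≠ g 1 := hg.ne (by decide)
      simp only [Matrix.submatrix_apply]
      rcases lt_or_gt_of_ne hf01 with hlf | hlf <;> rcases lt_or_gt_of_ne hg01 with hlg | hlg <;>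
        have := h2 _ _ _ _ hlf hlg <;> contrapose! this <;>
        first | linear_combination this | linear_combination -this
    · let e := Equiv.ofBijective f (Finite.injective_iff_bijective.mp hf)
      let e' := Equiv.ofBijective g (Finite.injective_iff_bijective.mp hg)
      have key : (M.submatrix f g).det =
          Equiv.Perm.sign e * (Equiv.Perm.sign e' * M.det) := by
        rw [← Matrix.det_permute' e', ← Matrix.det_permute e]
        rfl
      rw [key]
      rcases Int.units_eq_one_or (Equiv.Perm.sign e) with he | he <;>
        rcases Int.units_eq_one_or (Equiv.Perm.sign e') with he' | he' <;>
        simpa [he, he'] using h3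

theorem mds_3x3_representative_iff {F : Type*} [Field F] [Fintype F] (hF : CharP F 2)
    (a b c d : F) :
    IsMDS (Matrix.of ![![1, 1, 1], ![1, a, b], ![1, c, d]]) ↔
      a ≠ 0 ∧ a ≠ 1 ∧ b ≠ 0 ∧ b ≠ 1 ∧ c ≠ 0 ∧ c ≠ 1 ∧ d ≠ 0 ∧ d ≠ 1 ∧
      b ≠ a ∧ c ≠ a ∧ d ≠ b ∧ d ≠ c ∧
      a * d ≠ b * c ∧
      (a + 1) * (d + 1) ≠ (b + 1) * (c + 1) := by
  have hdet : (Matrix.of ![![1, 1, 1], ![1, a, b], ![1, c, d]]).det =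
      (a + 1) * (d + 1) - (b + 1) * (c + 1) := by
    rw [← CharTwo.sub_eq_add a, ← CharTwo.sub_eq_add b, ← CharTwo.sub_eq_add c,
      ← CharTwo.sub_eq_add d, Matrix.det_fin_three]
    simp
    ring
  rw [isMDS_fin_three_iff, hdet]
  simp [Fin.forall_fin_succ, sub_eq_zero]
  tauto
end

section
/- Let F be a finite field of characteristic 2 with q = 2^m elements. The number of 3×3 representative MDS matrices over F, i.e., the number of tuples (a,b,c,d) ∈ F⁴ such that the matrix with rows (1,1,1), (1,a,b), (1,c,d) is MDS, equals (as an integer) (q−2)·(q−3)·(q²−9q+21). -/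
theorem isMDS_representative_iff {F : Type*} [Field F] (a b c d : F) :
    IsMDS (Matrix.of ![![1, 1, 1], ![1, a, b], ![1, c, d]]) ↔
      (a ≠ 0 ∧ a ≠ 1 ∧ b ≠ 0 ∧ b ≠ 1 ∧ a ≠ b) ∧ (c ≠ 0 ∧ c ≠ 1 ∧ c ≠ a) ∧
        d ≠ 0 ∧ d ≠ 1 ∧ d ≠ b ∧ d ≠ c ∧ a * d ≠ b * c ∧
          (a - 1) * (d - 1) ≠ (b - 1) * (c - 1) := by
  have hdet : a * d - b * c - d + b + c - a = (a - 1) * (d - 1) - (b - 1) * (c - 1) := by ring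
  rw [isMDS_fin_three_iff]
  simp [Fin.forall_fin_succ, Matrix.det_fin_three, hdet]
  simp only [sub_eq_zero]
  grind

theorem card_forbidden {F : Type*} [Field F] [DecidableEq F] {a b c : F}
    (ha0 : a ≠ 0) (ha1 : a ≠ 1) (hb0 : b ≠ 0) (hb1 : b ≠ 1) (hab : a ≠ b)
    (hc0 : c ≠ 0) (hc1 : c ≠ 1) (hca : c ≠ a) :
    ((({0, 1 + (b - 1) * (c - 1) / (a - 1)} ∪ ({1, b * c / a} ∪ {b, c}) : Finset F).card : ℕ) : ℤ)
      = 6 - (if c = (b - a) / (b - 1) then 1 else 0) - (if c = a / b then 1 else 0)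
        - (if c = b then 1 else 0) := by
  have ha1' := sub_ne_zero.mpr ha1
  have hb1' := sub_ne_zero.mpr hb1
  have hc1' := sub_ne_zero.mpr hc1
  have hab' := sub_ne_zero.mpr hab
  have hca' := sub_ne_zero.mpr hca
  obtain ⟨e, he⟩ : ∃ e, e = b * c / a := ⟨_, rfl⟩
  obtain ⟨f, hf⟩ : ∃ f, f = 1 + (b - 1) * (c - 1) / (a - 1) := ⟨_, rfl⟩
  rw [← he, ← hf]
  have hea : a * e = b * c := by rw [he]; field_simp
  have hfa : (a - 1) * (f - 1) = (b - 1) * (c - 1) := by rw [hf]; field_simp; ring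
  have e0 : e ≠ 0 := by rw [he]; exact div_ne_zero (mul_ne_zero hb0 hc0) ha0
  have eb : e ≠ b := by
    rintro rfl
    exact mul_ne_zero hb0 hca' (by linear_combination -hea)
  have ec : e ≠ c := by
    rintro rfl
    exact mul_ne_zero hc0 hab' (by linear_combination hea)
  have f1 : f ≠ 1 := by
    rintro rfl
    exact mul_ne_zero hb1' hc1' (by linear_combination -hfa)
  have fb : f ≠ b := by
    rintro rfl
    exact mul_ne_zero hb1' hca' (by linear_combination -hfa)
  have fc : f ≠ c := by
    rintro rfl
    exact mul_ne_zero hc1' hab' (by linear_combination hfa)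
  have ef : f ≠ e := by
    rintro rfl
    exact mul_ne_zero hab' hca' (by linear_combination a * hfa - (a - 1) * hea)
  have e1 : c = a / b ↔ 1 = e := by
    rw [eq_div_iff hb0, he, eq_div_iff ha0]
    constructor <;> intro h <;> linear_combination -h
  have f0 : c = (b - a) / (b - 1) ↔ 0 = f := by
    rw [eq_div_iff hb1']
    constructor
    · intro h
      refine mul_left_cancel₀ ha1' ?_
      linear_combination -hfa - h
    · rintro rfl
      linear_combination -hfa
  have cb : c = b ↔ b = c := eq_comm
  have pair : ∀ x y : F, (({x, y} : Finset F).card : ℤ) = 2 - if x = y then 1 else 0 := by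
    intro x y
    by_cases h : x = y
    · simp [h]
    · simp [h, Finset.card_pair h]
  rw [Finset.card_union_of_disjoint, Finset.card_union_of_disjoint]
  · push_cast
    rw [pair, pair, pair]
    simp only [e1, f0, cb]
    ring
  · simp [eb.symm, ec.symm, hb1, hc1]
  · simp [e0, f1.symm, fb.symm, fc.symm, ef.symm, hb0, hc0]

theorem card_last_entry {F : Type*} [Field F] [Fintype F] [DecidableEq F] {a b c : F}
    (ha0 : a ≠ 0) (ha1 : a ≠ 1) (hb0 : b ≠ 0) (hb1 : b ≠ 1) (hab : a ≠ b)
    (hc0 : c ≠ 0) (hc1 : c ≠ 1) (hca : c ≠ a) :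
    (∑ d : F, if d ≠ 0 ∧ d ≠ 1 ∧ d ≠ b ∧ d ≠ c ∧ a * d ≠ b * c ∧
        (a - 1) * (d - 1) ≠ (b - 1) * (c - 1) then (1 : ℤ) else 0) =
      (Fintype.card F - 6 : ℤ) + (if c = (b - a) / (b - 1) then 1 else 0)
        + (if c = a / b then 1 else 0) + (if c = b then 1 else 0) := by
  have ha1' := sub_ne_zero.mpr ha1
  have h := card_forbidden ha0 ha1 hb0 hb1 hab hc0 hc1 hca
  rw [Finset.sum_boole]
  have hs : (Finset.univ.filter fun d : F => d ≠ 0 ∧ d ≠ 1 ∧ d ≠ b ∧ d ≠ c ∧ a * d ≠ b * c ∧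
        (a - 1) * (d - 1) ≠ (b - 1) * (c - 1)) =
      ({0, 1 + (b - 1) * (c - 1) / (a - 1)} ∪ ({1, b * c / a} ∪ {b, c}) : Finset F)ᶜ := by
    ext d
    have h1 : a * d = b * c ↔ d = b * c / a := by rw [eq_div_iff ha0, mul_comm]
    have h2 : (a - 1) * (d - 1) = (b - 1) * (c - 1) ↔
        d = 1 + (b - 1) * (c - 1) / (a - 1) := by
      rw [← sub_eq_iff_eq_add', eq_div_iff ha1', mul_comm]
    simp only [ne_eq, h1, h2, Finset.mem_filter, Finset.mem_univ, true_and, Finset.mem_compl,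
      Finset.mem_union, Finset.mem_insert, Finset.mem_singleton]
    tauto
  rw [hs, Finset.card_compl, Nat.cast_sub (Finset.card_le_univ _), h]
  ring

theorem card_last_row {F : Type*} [Field F] [Fintype F] [DecidableEq F] {a b : F}
    (ha0 : a ≠ 0) (ha1 : a ≠ 1) (hb0 : b ≠ 0) (hb1 : b ≠ 1) (hab : a ≠ b) :
    (∑ c : F, ∑ d : F, if (c ≠ 0 ∧ c ≠ 1 ∧ c ≠ a) ∧ d ≠ 0 ∧ d ≠ 1 ∧ d ≠ b ∧ d ≠ c ∧
        a * d ≠ b * c ∧ (a - 1) * (d - 1) ≠ (b - 1) * (c - 1) then (1 : ℤ) else 0) =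
      (Fintype.card F : ℤ) ^ 2 - 9 * (Fintype.card F : ℤ) + 21 := by
  have ha1' := sub_ne_zero.mpr ha1
  have hb1' := sub_ne_zero.mpr hb1
  have hab' := sub_ne_zero.mpr hab
  have hs : ∀ c : F, (∑ d : F, if (c ≠ 0 ∧ c ≠ 1 ∧ c ≠ a) ∧ d ≠ 0 ∧ d ≠ 1 ∧ d ≠ b ∧ d ≠ c ∧
        a * d ≠ b * c ∧ (a - 1) * (d - 1) ≠ (b - 1) * (c - 1) then (1 : ℤ) else 0) =
      if c ∈ ({0, 1, a} : Finset F)ᶜ then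
        (Fintype.card F - 6 : ℤ) + (if c = (b - a) / (b - 1) then 1 else 0)
          + (if c = a / b then 1 else 0) + (if c = b then 1 else 0) else 0 := by
    intro c
    by_cases hc : c ≠ 0 ∧ c ≠ 1 ∧ c ≠ a
    · rw [if_pos (by simpa using hc), ← card_last_entry ha0 ha1 hb0 hb1 hab hc.1 hc.2.1 hc.2.2]
      simp only [hc, ne_eq, not_false_eq_true, true_and]
    · rw [if_neg (by simpa using hc)]
      simp only [hc, false_and, if_false, Finset.sum_const_zero]
  have hcard : ((({0, 1, a} : Finset F)ᶜ.card : ℕ) : ℤ) = Fintype.card F - 3 := by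
    rw [Finset.card_compl, Nat.cast_sub (Finset.card_le_univ _),
      Finset.card_eq_three.mpr ⟨0, 1, a, zero_ne_one, ha0.symm, ha1.symm, rfl⟩]
    rfl
  have m1 : (b - a) / (b - 1) ∈ ({0, 1, a} : Finset F)ᶜ := by
    simp only [Finset.mem_compl, Finset.mem_insert, Finset.mem_singleton, not_or]
    refine ⟨div_ne_zero (sub_ne_zero.mpr hab.symm) hb1', fun h => ?_, fun h => ?_⟩
    · rw [div_eq_iff hb1'] at h
      exact ha1' (by linear_combination -h)
    · rw [div_eq_iff hb1'] at h
      exact mul_ne_zero hb0 ha1' (by linear_combination -h)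
  have m2 : a / b ∈ ({0, 1, a} : Finset F)ᶜ := by
    simp only [Finset.mem_compl, Finset.mem_insert, Finset.mem_singleton, not_or]
    refine ⟨div_ne_zero ha0 hb0, fun h => ?_, fun h => ?_⟩
    · rw [div_eq_iff hb0] at h
      exact hab' (by linear_combination h)
    · rw [div_eq_iff hb0] at h
      exact mul_ne_zero ha0 hb1' (by linear_combination -h)
  have m3 : b ∈ ({0, 1, a} : Finset F)ᶜ := by simp [hb0, hb1, hab.symm]
  rw [Finset.sum_congr rfl fun c _ => hs c, Finset.sum_ite_mem, Finset.univ_inter,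
    Finset.sum_add_distrib, Finset.sum_add_distrib, Finset.sum_add_distrib, Finset.sum_const,
    Finset.sum_ite_eq', Finset.sum_ite_eq', Finset.sum_ite_eq', if_pos m1, if_pos m2, if_pos m3,
    nsmul_eq_mul, hcard]
  ring

theorem card_middle_row {F : Type*} [Field F] [Fintype F] [DecidableEq F] :
    (∑ a : F, ∑ b : F, if a ≠ 0 ∧ a ≠ 1 ∧ b ≠ 0 ∧ b ≠ 1 ∧ a ≠ b then (1 : ℤ) else 0) =
      ((Fintype.card F : ℤ) - 2) * ((Fintype.card F : ℤ) - 3) := by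
  have hs : ∀ a : F, (∑ b : F, if a ≠ 0 ∧ a ≠ 1 ∧ b ≠ 0 ∧ b ≠ 1 ∧ a ≠ b then (1 : ℤ) else 0) =
      if a ∈ ({0, 1} : Finset F)ᶜ then (Fintype.card F - 3 : ℤ) else 0 := by
    intro a
    by_cases ha : a ≠ 0 ∧ a ≠ 1
    · have hf : (Finset.univ.filter fun b : F => a ≠ 0 ∧ a ≠ 1 ∧ b ≠ 0 ∧ b ≠ 1 ∧ a ≠ b) =
          ({0, 1, a} : Finset F)ᶜ := by
        ext b
        simp [ha, eq_comm]
      rw [if_pos (by simpa using ha), Finset.sum_boole, hf, Finset.card_compl,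
        Nat.cast_sub (Finset.card_le_univ _),
        Finset.card_eq_three.mpr ⟨0, 1, a, zero_ne_one, ha.1.symm, ha.2.symm, rfl⟩]
      rfl
    · rw [if_neg (by simpa using ha)]
      refine Finset.sum_eq_zero fun b _ => if_neg fun h => ha ⟨h.1, h.2.1⟩
  rw [Finset.sum_congr rfl fun a _ => hs a, Finset.sum_ite_mem, Finset.univ_inter,
    Finset.sum_const, nsmul_eq_mul, Finset.card_compl, Nat.cast_sub (Finset.card_le_univ _),
    Finset.card_pair zero_ne_one]
  rfl

theorem card_3x3_representative_mds {F : Type*} [Field F] [Fintype F] (hF : CharP F 2) :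
    (Nat.card {v : F × F × F × F //
        IsMDS (Matrix.of ![![1, 1, 1], ![1, v.1, v.2.1], ![1, v.2.2.1, v.2.2.2]])} : ℤ) =
      ((Fintype.card F : ℤ) - 2) * ((Fintype.card F : ℤ) - 3) *
        ((Fintype.card F : ℤ) ^ 2 - 9 * (Fintype.card F : ℤ) + 21) := by
  classical
  rw [Nat.card_eq_fintype_card, Fintype.card_subtype, ← Finset.sum_boole]
  simp only [Fintype.sum_prod_type, isMDS_representative_iff]
  rw [← card_middle_row, Finset.sum_mul]
  refine Finset.sum_congr rfl fun a _ => ?_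
  rw [Finset.sum_mul]
  refine Finset.sum_congr rfl fun b _ => ?_
  by_cases h : a ≠ 0 ∧ a ≠ 1 ∧ b ≠ 0 ∧ b ≠ 1 ∧ a ≠ b
  · obtain ⟨ha0, ha1, hb0, hb1, hab⟩ := id h
    rw [if_pos h, one_mul, ← card_last_row ha0 ha1 hb0 hb1 hab]
    simp only [h, ne_eq, not_false_eq_true, true_and]
  · simp only [h, false_and, if_false, Finset.sum_const_zero, zero_mul]
end

section
/- Let F be a finite field of characteristic 2 with q = 2^m elements. The number of 3×3 MDS matrices over F equals (as an integer) (q−1)⁵·(q−2)·(q−3)·(q²−9q+21). -/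
theorem isMDS_three_iff {F : Type*} [Field F] (M : Matrix (Fin 3) (Fin 3) F) :
    IsMDS M ↔ (∀ i j, M i j ≠ 0) ∧
      (∀ i i' j j', i ≠ i' → j ≠ j' → M i j * M i' j' - M i j' * M i' j ≠ 0) ∧ M.det ≠ 0 := by
  constructor
  · intro h
    refine ⟨fun i j => ?_, fun i i' j j' hi hj => ?_, ?_⟩
    · have := h 1 le_rfl ![i] ![j] (Function.injective_of_subsingleton _)
        (Function.injective_of_subsingleton _)
      rwa [Matrix.det_fin_one] at this
    · have := h 2 (by norm_num) ![i, i'] ![j, j'] (by simpa [Function.Injective, Fin.forall_fin_two]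
        using ⟨hi, hi.symm⟩) (by simpa [Function.Injective, Fin.forall_fin_two] using ⟨hj, hj.symm⟩)
      rwa [Matrix.det_fin_two] at this
    · simpa using h 3 (by norm_num) id id Function.injective_id Function.injective_id
  · rintro ⟨h1, h2, h3⟩ k hk f g hf hg
    have hk3 : k ≤ 3 := by simpa using Fintype.card_le_of_injective f hf
    interval_cases k
    · simpa using h1 (f 0) (g 0)
    · rw [Matrix.det_fin_two]
      exact h2 _ _ _ _ (hf.ne (by decide)) (hg.ne (by decide))
    · have key := Matrix.isUnit_submatrix_equiv (A := M)
        (Equiv.ofBijective f (Finite.injective_iff_bijective.1 hf))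
        (Equiv.ofBijective g (Finite.injective_iff_bijective.1 hg))
      rw [Matrix.isUnit_iff_isUnit_det, Matrix.isUnit_iff_isUnit_det, isUnit_iff_ne_zero,
        isUnit_iff_ne_zero] at key
      exact key.2 h3

theorem IsMDS.scale {F : Type*} [Field F] {n : ℕ} {M : Matrix (Fin n) (Fin n) F} (hM : IsMDS M)
    (r s : Fin n → Fˣ) : IsMDS (Matrix.of fun i j => (r i : F) * ((s j : F) * M i j)) := by
  intro k hk f g hf hg
  have : ((Matrix.of fun i j => (r i : F) * ((s j : F) * M i j)).submatrix f g) =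
      Matrix.of fun i j => (r (f i) : F) *
        (Matrix.of fun i j => (s (g j) : F) * M.submatrix f g i j) i j := rfl
  rw [this, Matrix.det_mul_column, Matrix.det_mul_row]
  exact mul_ne_zero (Finset.prod_ne_zero_iff.2 fun i _ => (r (f i)).ne_zero)
    (mul_ne_zero (Finset.prod_ne_zero_iff.2 fun i _ => (s (g i)).ne_zero) (hM k hk f g hf hg))

/-- The `3 × 3` matrix with first row and first column equal to `1` and the given lower right
block. -/
def borderedMatrix {F : Type*} [Field F] (t : F × F × F × F) : Matrix (Fin 3) (Fin 3) F :=
  !![1, 1, 1; 1, t.1, t.2.1; 1, t.2.2.1, t.2.2.2]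

theorem IsMDS.entry_ne_zero {F : Type*} [Field F] {M : Matrix (Fin 3) (Fin 3) F} (hM : IsMDS M)
    (i j : Fin 3) : M i j ≠ 0 :=
  ((isMDS_three_iff M).1 hM).1 i j

/-- Scaling rows and columns puts a `3 × 3` MDS matrix uniquely into bordered form. -/
noncomputable def mdsEquivBordered (F : Type*) [Field F] :
    {M : Matrix (Fin 3) (Fin 3) F // IsMDS M} ≃
      ((Fin 3 → Fˣ) × (Fin 2 → Fˣ)) × {t : F × F × F × F // IsMDS (borderedMatrix t)} where
  toFun M :=
    let m i j := Units.mk0 (M.1 i j) (M.2.entry_ne_zero i j)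
    ((m 0, fun i => m i.succ 0 / m 0 0),
      ⟨(M.1 0 0 * M.1 1 1 / (M.1 1 0 * M.1 0 1), M.1 0 0 * M.1 1 2 / (M.1 1 0 * M.1 0 2),
        M.1 0 0 * M.1 2 1 / (M.1 2 0 * M.1 0 1), M.1 0 0 * M.1 2 2 / (M.1 2 0 * M.1 0 2)), by
        convert M.2.scale (fun i => m 0 0 / m i 0) (fun j => 1 / m 0 j) using 1
        have h := M.2.entry_ne_zero
        ext i j
        fin_cases i <;> fin_cases j <;> simp [borderedMatrix, m, h] <;> field_simp [h]⟩)
  invFun p := ⟨Matrix.of fun i j => ((![1, p.1.2 0, p.1.2 1] : Fin 3 → Fˣ) i : F) *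
    ((p.1.1 j : F) * borderedMatrix p.2.1 i j), p.2.2.scale ![1, p.1.2 0, p.1.2 1] p.1.1⟩
  left_inv M := by
    have h := M.2.entry_ne_zero
    ext i j
    fin_cases i <;> fin_cases j <;> simp [borderedMatrix] <;> field_simp [h]
  right_inv p := by
    obtain ⟨⟨s, r⟩, ⟨a, b, c, d⟩, hp⟩ := p
    refine Prod.ext (Prod.ext ?_ ?_) (Subtype.ext ?_)
    · ext j
      fin_cases j <;> simp [borderedMatrix]
    · ext i
      fin_cases i <;> simp [borderedMatrix]
    · simp [borderedMatrix]
      refine ⟨?_, ?_, ?_, ?_⟩ <;> field_simp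

theorem isMDS_borderedMatrix_iff {F : Type*} [Field F] (a b c d : F) :
    IsMDS (borderedMatrix (a, b, c, d)) ↔
      ((a ≠ 0 ∧ a ≠ 1) ∧ b ≠ 0 ∧ b ≠ 1 ∧ b ≠ a) ∧ (c ≠ 0 ∧ c ≠ 1 ∧ c ≠ a) ∧
        d ≠ 0 ∧ d ≠ 1 ∧ d ≠ b ∧ d ≠ c ∧ a * d ≠ b * c ∧
          (a - 1) * (d - 1) ≠ (b - 1) * (c - 1) := by
  have hdet : (borderedMatrix (a, b, c, d)).det = (a - 1) * (d - 1) - (b - 1) * (c - 1) := by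
    simp [borderedMatrix, Matrix.det_fin_three]
    ring
  rw [isMDS_three_iff, hdet]
  simp only [Fin.forall_fin_succ, borderedMatrix]
  simp [sub_eq_zero]
  rw [mul_comm c b, mul_comm d a]
  grind

theorem card_three_pairs {F : Type*} [DecidableEq F] {x x' y y' z z' : F}
    (h₁ : x ≠ y) (h₂ : x ≠ y') (h₃ : x' ≠ y) (h₄ : x' ≠ y') (h₅ : x ≠ z) (h₆ : x ≠ z')
    (h₇ : x' ≠ z) (h₈ : x' ≠ z') (h₉ : y ≠ z) (h₁₀ : y ≠ z') (h₁₁ : y' ≠ z) (h₁₂ : y' ≠ z') :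
    ((({x, x', y, y', z, z'} : Finset F).card : ℕ) : ℤ) =
      6 - (if x = x' then 1 else 0) - (if y = y' then 1 else 0) - (if z = z' then 1 else 0) := by
  by_cases hx : x = x' <;> by_cases hy : y = y' <;> by_cases hz : z = z' <;>
    simp_all [Finset.card_insert_of_notMem]

theorem sum_last_entry {F : Type*} [Field F] [Fintype F] [DecidableEq F] {a b c : F}
    (ha0 : a ≠ 0) (ha1 : a ≠ 1) (hb0 : b ≠ 0) (hb1 : b ≠ 1) (hba : b ≠ a)
    (hc0 : c ≠ 0) (hc1 : c ≠ 1) (hca : c ≠ a) :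
    (∑ d : F, if d ≠ 0 ∧ d ≠ 1 ∧ d ≠ b ∧ d ≠ c ∧ a * d ≠ b * c ∧
        (a - 1) * (d - 1) ≠ (b - 1) * (c - 1) then (1 : ℤ) else 0) =
      (Fintype.card F - 6 : ℤ) + (if c = (b - a) / (b - 1) then 1 else 0) +
        (if c = a / b then 1 else 0) + (if c = b then 1 else 0) := by
  have ha1' : a - 1 ≠ 0 := sub_ne_zero.2 ha1
  have hb1' : b - 1 ≠ 0 := sub_ne_zero.2 hb1
  have hc1' : c - 1 ≠ 0 := sub_ne_zero.2 hc1
  obtain ⟨e, he⟩ : ∃ e, (a - 1) * (e - 1) = (b - 1) * (c - 1) :=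
    ⟨1 + (b - 1) * (c - 1) / (a - 1), by field_simp; ring⟩
  obtain ⟨f, hf⟩ : ∃ f, a * f = b * c := ⟨b * c / a, by field_simp⟩
  have hfilter : (Finset.univ.filter fun d : F => d ≠ 0 ∧ d ≠ 1 ∧ d ≠ b ∧ d ≠ c ∧ a * d ≠ b * c ∧
      (a - 1) * (d - 1) ≠ (b - 1) * (c - 1)) = ({0, e, 1, f, b, c} : Finset F)ᶜ := by
    ext d
    rw [← he, ← hf]
    simp [ha0, ha1']
    tauto
  have hba' : b - a ≠ 0 := sub_ne_zero.2 hba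
  have hca' : c - a ≠ 0 := sub_ne_zero.2 hca
  have hcard := card_three_pairs (x := 0) (x' := e) (y := 1) (y' := f) (z := b) (z' := c)
    (by simp) (by rintro rfl; simp_all) (by rintro rfl; simp_all)
    (by
      rintro rfl
      exact mul_ne_zero hba' hca' (by linear_combination (a - 1) * hf - a * he))
    hb0.symm hc0.symm
    (by
      rintro rfl
      exact mul_ne_zero hb1' hca' (by linear_combination -he))
    (by
      rintro rfl
      exact mul_ne_zero hc1' hba' (by linear_combination -he))
    hb1.symm hc1.symm
    (by
      rintro rfl
      exact mul_ne_zero hb0 hca' (by linear_combination -hf))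
    (by
      rintro rfl
      exact mul_ne_zero hc0 hba' (by linear_combination -hf))
  have h0 : (0 = e) ↔ c = (b - a) / (b - 1) := by
    rw [eq_div_iff hb1']
    constructor
    · rintro rfl
      linear_combination -he
    · intro h
      have : (a - 1) * e = 0 := by linear_combination he + h
      simpa [ha1', eq_comm] using this
  have h1 : (1 = f) ↔ c = a / b := by
    rw [eq_div_iff hb0]
    constructor
    · rintro rfl
      linear_combination -hf
    · intro h
      exact mul_left_cancel₀ ha0 (by linear_combination -hf - h)
  rw [Finset.sum_boole, hfilter, Finset.card_compl, Nat.cast_sub (Finset.card_le_univ _), hcard]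
  simp only [h0, h1, eq_comm (a := b)]
  ring

theorem sum_second_row {F : Type*} [Field F] [Fintype F] [DecidableEq F] {a b : F}
    (ha0 : a ≠ 0) (ha1 : a ≠ 1) (hb0 : b ≠ 0) (hb1 : b ≠ 1) (hba : b ≠ a) :
    (∑ c : F, ∑ d : F, if (c ≠ 0 ∧ c ≠ 1 ∧ c ≠ a) ∧
        d ≠ 0 ∧ d ≠ 1 ∧ d ≠ b ∧ d ≠ c ∧ a * d ≠ b * c ∧
        (a - 1) * (d - 1) ≠ (b - 1) * (c - 1) then (1 : ℤ) else 0) =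
      (Fintype.card F : ℤ) ^ 2 - 9 * Fintype.card F + 21 := by
  have hb1' : b - 1 ≠ 0 := sub_ne_zero.2 hb1
  have hba' : b - a ≠ 0 := sub_ne_zero.2 hba
  have hinner : ∀ c : F, (∑ d : F, if (c ≠ 0 ∧ c ≠ 1 ∧ c ≠ a) ∧
        d ≠ 0 ∧ d ≠ 1 ∧ d ≠ b ∧ d ≠ c ∧ a * d ≠ b * c ∧
        (a - 1) * (d - 1) ≠ (b - 1) * (c - 1) then (1 : ℤ) else 0) =
      if c ∈ ({0, 1, a} : Finset F)ᶜ then (Fintype.card F - 6 : ℤ) +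
        (if c = (b - a) / (b - 1) then 1 else 0) +
        (if c = a / b then 1 else 0) + (if c = b then 1 else 0) else 0 := by
    intro c
    by_cases hc : c ≠ 0 ∧ c ≠ 1 ∧ c ≠ a
    · rw [if_pos (by simpa using hc), ← sum_last_entry ha0 ha1 hb0 hb1 hba hc.1 hc.2.1 hc.2.2]
      simp only [hc, ne_eq, not_false_eq_true, true_and]
    · rw [if_neg (by simpa using hc)]
      simp only [hc, false_and, if_false, Finset.sum_const_zero]
  have m₁ : (b - a) / (b - 1) ∈ ({0, 1, a} : Finset F)ᶜ := by
    have h₁ : ¬ b - a = b - 1 := fun h => ha1 (by linear_combination -h)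
    have h₂ : ¬ b - a = a * (b - 1) := fun h =>
      mul_ne_zero hb0 (sub_ne_zero.2 ha1) (by linear_combination -h)
    simp [div_eq_iff hb1', hba', h₁, h₂]
  have m₂ : a / b ∈ ({0, 1, a} : Finset F)ᶜ := by
    simp [div_eq_iff hb0, ha0, hba.symm, hb1]
  have m₃ : b ∈ ({0, 1, a} : Finset F)ᶜ := by simp [hb0, hb1, hba]
  have hcard : ((({0, 1, a} : Finset F)ᶜ.card : ℕ) : ℤ) = Fintype.card F - 3 := by
    rw [Finset.card_compl, Nat.cast_sub (Finset.card_le_univ _)]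
    simp [Finset.card_insert_of_notMem, ha0.symm, ha1.symm]
  simp_rw [hinner]
  rw [Finset.sum_ite_mem, Finset.univ_inter]
  simp only [Finset.sum_add_distrib, Finset.sum_ite_eq', m₁, m₂, m₃, if_true, Finset.sum_const,
    nsmul_eq_mul, hcard]
  ring

theorem sum_first_row {F : Type*} [Field F] [Fintype F] [DecidableEq F] :
    (∑ a : F, ∑ b : F, if (a ≠ 0 ∧ a ≠ 1) ∧ b ≠ 0 ∧ b ≠ 1 ∧ b ≠ a then (1 : ℤ) else 0) =
      ((Fintype.card F : ℤ) - 2) * ((Fintype.card F : ℤ) - 3) := by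
  have hinner : ∀ a : F,
      (∑ b : F, if (a ≠ 0 ∧ a ≠ 1) ∧ b ≠ 0 ∧ b ≠ 1 ∧ b ≠ a then (1 : ℤ) else 0) =
      if a ∈ ({0, 1} : Finset F)ᶜ then (Fintype.card F - 3 : ℤ) else 0 := by
    intro a
    by_cases ha : a ≠ 0 ∧ a ≠ 1
    · have hfilter : (Finset.univ.filter fun b : F => b ≠ 0 ∧ b ≠ 1 ∧ b ≠ a) =
          ({0, 1, a} : Finset F)ᶜ := by
        ext
        simp
      rw [if_pos (by simpa using ha)]
      simp only [ha, ne_eq, not_false_eq_true, true_and]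
      rw [Finset.sum_boole, hfilter, Finset.card_compl, Nat.cast_sub (Finset.card_le_univ _)]
      simp [Finset.card_insert_of_notMem, ha.1.symm, ha.2.symm]
    · rw [if_neg (by simpa using ha)]
      simp only [ha, false_and, if_false, Finset.sum_const_zero]
  have hcard : ((({0, 1} : Finset F)ᶜ.card : ℕ) : ℤ) = Fintype.card F - 2 := by
    rw [Finset.card_compl, Nat.cast_sub (Finset.card_le_univ _)]
    simp [Finset.card_insert_of_notMem]
  simp_rw [hinner]
  rw [Finset.sum_ite_mem, Finset.univ_inter, Finset.sum_const, nsmul_eq_mul, hcard]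

theorem card_borderedMatrix_isMDS (F : Type*) [Field F] [Fintype F] :
    (Nat.card {t : F × F × F × F // IsMDS (borderedMatrix t)} : ℤ) =
      ((Fintype.card F : ℤ) - 2) * ((Fintype.card F : ℤ) - 3) *
        ((Fintype.card F : ℤ) ^ 2 - 9 * (Fintype.card F : ℤ) + 21) := by
  classical
  rw [Nat.card_eq_fintype_card, Fintype.card_subtype, ← Finset.sum_boole]
  simp only [Fintype.sum_prod_type, isMDS_borderedMatrix_iff]
  rw [← sum_first_row, Finset.sum_mul]
  refine Finset.sum_congr rfl fun a _ => ?_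
  rw [Finset.sum_mul]
  refine Finset.sum_congr rfl fun b _ => ?_
  by_cases h : (a ≠ 0 ∧ a ≠ 1) ∧ b ≠ 0 ∧ b ≠ 1 ∧ b ≠ a
  · rw [if_pos h, one_mul, ← sum_second_row h.1.1 h.1.2 h.2.1 h.2.2.1 h.2.2.2]
    simp only [h, ne_eq, not_false_eq_true, true_and]
  · simp only [h, false_and, if_false, Finset.sum_const_zero, zero_mul]

theorem card_3x3_mds {F : Type*} [Field F] [Fintype F] (hF : CharP F 2) :
    (Nat.card {M : Matrix (Fin 3) (Fin 3) F // IsMDS M} : ℤ) =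
      ((Fintype.card F : ℤ) - 1) ^ 5 * ((Fintype.card F : ℤ) - 2) *
        ((Fintype.card F : ℤ) - 3) *
        ((Fintype.card F : ℤ) ^ 2 - 9 * (Fintype.card F : ℤ) + 21) := by
  have hunits : ((Nat.card Fˣ : ℕ) : ℤ) = Fintype.card F - 1 := by
    rw [Nat.card_units, Nat.card_eq_fintype_card, Nat.cast_sub Fintype.card_pos, Nat.cast_one]
  rw [Nat.card_congr (mdsEquivBordered F), Nat.card_prod, Nat.card_prod, Nat.card_fun, Nat.card_fun]
  push_cast
  rw [card_borderedMatrix_isMDS, hunits]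
  simp only [Nat.card_eq_fintype_card, Fintype.card_fin]
  ring
end

section
/- Let F be a finite field of characteristic 2 with q = 2^m elements. The number of 3×3 matrices M over F that are both involutory (M² = I) and MDS equals (as an integer) (q−1)²·(q−2)·(q−4). -/
theorem Matrix.two_by_two_minor_ne_zero {F : Type*} [Field F] {M : Matrix (Fin 3) (Fin 3) F}
    (hM : M * M = 1) (hne : ∀ i j, M i j ≠ 0) {a b c d : Fin 3} (hab : a ≠ b) (hcd : c ≠ d) :
    M a c * M b d - M a d * M b c ≠ 0 := by
  intro h
  obtain ⟨e, he⟩ : ∃ e : Fin 3, ∀ k, k = a ∨ k = b ∨ k = e := by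
    clear h; revert a b; decide
  obtain ⟨f, hfc, hfd⟩ : ∃ f : Fin 3, f ≠ c ∧ f ≠ d := by
    clear h; revert c d; decide
  have hsum (i : Fin 3) : (1 : Matrix (Fin 3) (Fin 3) F) i c * M b d
      - (1 : Matrix (Fin 3) (Fin 3) F) i d * M b c
      = ∑ k, M i k * (M k c * M b d - M k d * M b c) := by
    simp only [← hM, Matrix.mul_apply, Finset.sum_mul, ← Finset.sum_sub_distrib]
    exact Finset.sum_congr rfl fun k _ => by ring
  have hrow (k : Fin 3) (hk : k ≠ e) : M k c * M b d - M k d * M b c = 0 := by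
    rcases he k with rfl | rfl | rfl
    · exact h
    · ring
    · exact absurd rfl hk
  have hsingle (i : Fin 3) : ∑ k, M i k * (M k c * M b d - M k d * M b c)
      = M i e * (M e c * M b d - M e d * M b c) :=
    Finset.sum_eq_single e (fun k _ hk => by rw [hrow k hk, mul_zero]) (by simp)
  have hf := (hsum f).trans (hsingle f)
  have hc := (hsum c).trans (hsingle c)
  rw [Matrix.one_apply_ne hfc, Matrix.one_apply_ne hfd, zero_mul, zero_mul, sub_zero] at hf
  have ht := (mul_eq_zero.1 hf.symm).resolve_left (hne f e)
  rw [ht, Matrix.one_apply_eq, Matrix.one_apply_ne hcd] at hc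
  exact hne b d (by simpa using hc)

theorem isMDS_iff_of_mul_self_eq_one {F : Type*} [Field F] {M : Matrix (Fin 3) (Fin 3) F}
    (hM : M * M = 1) : IsMDS M ↔ ∀ i j, M i j ≠ 0 := by
  constructor
  · intro h i j
    simpa using h 1 le_rfl (fun _ => i) (fun _ => j)
      (Function.injective_of_subsingleton _) (Function.injective_of_subsingleton _)
  · intro h k hk f g hf hg
    have hk3 : k ≤ 3 := by simpa using Fintype.card_le_of_injective f hf
    interval_cases k
    · simpa using h (f 0) (g 0)
    · rw [Matrix.det_fin_two]
      exact Matrix.two_by_two_minor_ne_zero hM h (hf.ne (by decide)) (hg.ne (by decide))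
    · have hu : IsUnit (M.submatrix f g) :=
        (Matrix.isUnit_submatrix_equiv (Equiv.ofBijective f (Finite.injective_iff_bijective.1 hf))
          (Equiv.ofBijective g (Finite.injective_iff_bijective.1 hg))).2
          (IsUnit.of_mul_eq_one _ hM)
      exact ((Matrix.isUnit_iff_isUnit_det _).1 hu).ne_zero

/-- The rank-one perturbation `1 + u vᵀ` of the identity with `u = (1, a, b)` and
`v = (x, y / a, (x + y) / b)`. -/
def rankOnePerturbation {F : Type*} [Field F] (a b x y : F) : Matrix (Fin 3) (Fin 3) F :=
  !![1 + x, y / a, (x + y) / b;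
     a * x, 1 + y, a * (x + y) / b;
     b * x, b * y / a, 1 + x + y]

theorem rankOnePerturbation_mul_self {F : Type*} [Field F] [CharP F 2] {a b : F} (ha : a ≠ 0)
    (hb : b ≠ 0) (x y : F) :
    rankOnePerturbation a b x y * rankOnePerturbation a b x y = 1 := by
  have h2 : (2 : F) = 0 := CharTwo.two_eq_zero
  ext i j
  fin_cases i <;> fin_cases j <;>
    simp [rankOnePerturbation, Matrix.mul_apply, Fin.sum_univ_three] <;> grind

theorem rankOnePerturbation_apply_ne_zero {F : Type*} [Field F] [CharP F 2] {a b x y : F}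
    (ha : a ≠ 0) (hb : b ≠ 0) (hx : x ≠ 0 ∧ x ≠ 1) (hy : y ≠ 0 ∧ y ≠ 1 ∧ y ≠ x ∧ y ≠ x + 1)
    (i j : Fin 3) : rankOnePerturbation a b x y i j ≠ 0 := by
  have h2 : (2 : F) = 0 := CharTwo.two_eq_zero
  fin_cases i <;> fin_cases j <;> simp [rankOnePerturbation] <;> grind

/-- If `M + 1` squares to zero in characteristic two and its off-diagonal entries are nonzero, then
it is traceless and its `2 × 2` minors vanish, so that it has rank one. -/
theorem eq_rankOnePerturbation {F : Type*} [Field F] [CharP F 2] {M : Matrix (Fin 3) (Fin 3) F}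
    (hM : M * M = 1) (hne : ∀ i j, M i j ≠ 0) :
    M 0 0 + 1 ≠ 0 ∧ M 1 1 + 1 ≠ 0 ∧ M 2 2 + 1 ≠ 0 ∧ M 0 0 + M 1 1 + M 2 2 = 1 ∧
    rankOnePerturbation (M 1 0 / (M 0 0 + 1)) (M 2 0 / (M 0 0 + 1)) (M 0 0 + 1) (M 1 1 + 1)
      = M := by
  have h2 : (2 : F) = 0 := CharTwo.two_eq_zero
  have e (i j) := congrFun (congrFun hM i) j
  simp only [Matrix.mul_apply, Fin.sum_univ_three] at e
  have e00 := e 0 0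
  have e01 := e 0 1
  have e02 := e 0 2
  have e10 := e 1 0
  have e11 := e 1 1
  have e12 := e 1 2
  have e20 := e 2 0
  have e21 := e 2 1
  have e22 := e 2 2
  simp only [Matrix.one_apply, Fin.isValue, Fin.reduceEq, if_true, if_false] at *
  have n01 := hne 0 1
  have n02 := hne 0 2
  have n10 := hne 1 0
  have n12 := hne 1 2
  have n20 := hne 2 0
  have n21 := hne 2 1
  have htr : M 0 0 + M 1 1 + M 2 2 = 1 := by
    have : (M 0 0 + M 1 1 + M 2 2 + 1) ^ 2 = 0 := by
      grind
    have := pow_eq_zero_iff (two_ne_zero) |>.1 this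
    linear_combination this - h2
  have hp : M 0 2 * M 1 0 = M 1 2 * (M 0 0 + 1) := by grind
  have hq : M 0 1 * M 1 2 = M 0 2 * (M 1 1 + 1) := by grind
  have hr : M 0 2 * M 2 1 = M 0 1 * (M 2 2 + 1) := by grind
  have hp0 : M 0 0 + 1 ≠ 0 := right_ne_zero_of_mul (hp ▸ mul_ne_zero n02 n10)
  have hq0 : M 1 1 + 1 ≠ 0 := right_ne_zero_of_mul (hq ▸ mul_ne_zero n01 n12)
  have hr0 : M 2 2 + 1 ≠ 0 := right_ne_zero_of_mul (hr ▸ mul_ne_zero n02 n21)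
  have h01 : (M 1 1 + 1) * (M 0 0 + 1) = M 0 1 * M 1 0 :=
    mul_left_cancel₀ n12 (by linear_combination -M 1 0 * hq - (M 1 1 + 1) * hp)
  have h02 : (M 0 0 + 1 + (M 1 1 + 1)) * (M 0 0 + 1) = M 0 2 * M 2 0 :=
    mul_left_cancel₀ n01 (by grind)
  have h12 : M 1 0 * (M 0 0 + 1 + (M 1 1 + 1)) = M 1 2 * M 2 0 := by grind
  have h21 : M 2 0 * (M 1 1 + 1) = M 2 1 * M 1 0 := by grind
  refine ⟨hp0, hq0, hr0, htr, ?_⟩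
  ext i j
  fin_cases i <;> fin_cases j <;> simp [rankOnePerturbation]
  · linear_combination h2
  · field_simp
    linear_combination h01
  · field_simp
    linear_combination h02
  · field_simp
  · linear_combination h2
  · field_simp
    linear_combination h12
  · field_simp
  · field_simp
    linear_combination h21
  · linear_combination htr + (2 - M 2 2) * h2

theorem card_3x3_involutory_mds {F : Type*} [Field F] [Fintype F] (hF : CharP F 2) :
    (Nat.card {M : Matrix (Fin 3) (Fin 3) F // M * M = 1 ∧ IsMDS M} : ℤ) =
      ((Fintype.card F : ℤ) - 1) ^ 2 * ((Fintype.card F : ℤ) - 2) *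
        ((Fintype.card F : ℤ) - 4) := by
  classical
  have h2 : (2 : F) = 0 := CharTwo.two_eq_zero
  let S : Finset (F × F × (_ : F) × F) :=
    (Finset.univ \ {0}) ×ˢ (Finset.univ \ {0}) ×ˢ
      ((Finset.univ \ {0, 1}).sigma fun x => Finset.univ \ {0, 1, x, x + 1})
  have hS : Nat.card {M : Matrix (Fin 3) (Fin 3) F // M * M = 1 ∧ IsMDS M} = S.card := by
    rw [Nat.card_eq_fintype_card, Fintype.card_subtype]
    refine Finset.card_nbij'
      (fun M => (M 1 0 / (M 0 0 + 1), M 2 0 / (M 0 0 + 1), ⟨M 0 0 + 1, M 1 1 + 1⟩))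
      (fun p => rankOnePerturbation p.1 p.2.1 p.2.2.1 p.2.2.2) ?_ ?_ ?_ ?_
    · intro M hM
      simp only [Finset.coe_filter, Finset.mem_univ, true_and, Set.mem_ofPred_eq] at hM
      have hne := (isMDS_iff_of_mul_self_eq_one hM.1).1 hM.2
      obtain ⟨hx, hy, hz, ht, -⟩ := eq_rankOnePerturbation hM.1 hne
      have h00 := hne 0 0
      have h11 := hne 1 1
      have h22 := hne 2 2
      simp [S, hx, hy, hne]
      grind
    · rintro ⟨a, b, x, y⟩ hp
      simp [S] at hp
      have hM := rankOnePerturbation_mul_self hp.1 hp.2.1 x y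
      simp only [Finset.coe_filter, Finset.mem_univ, true_and, Set.mem_ofPred_eq]
      refine ⟨hM, (isMDS_iff_of_mul_self_eq_one hM).2 ?_⟩
      apply rankOnePerturbation_apply_ne_zero hp.1 hp.2.1 <;> tauto
    · intro M hM
      simp only [Finset.coe_filter, Finset.mem_univ, true_and, Set.mem_ofPred_eq] at hM
      have hne := (isMDS_iff_of_mul_self_eq_one hM.1).1 hM.2
      exact (eq_rankOnePerturbation hM.1 hne).2.2.2.2
    · rintro ⟨a, b, x, y⟩ hp
      simp [S] at hp
      have hx : 1 + x + 1 = x := by grind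
      have hy : 1 + y + 1 = y := by grind
      simp [rankOnePerturbation, hx, hy, hp]
  have hfib : ∀ x ∈ (Finset.univ \ {0, 1} : Finset F),
      ((Finset.univ \ {0, 1, x, x + 1} : Finset F).card : ℤ) = Fintype.card F - 4 := by
    intro x hx
    have hcard : ({0, 1, x, x + 1} : Finset F).card = 4 := by
      simp at hx
      grind
    rw [Finset.cast_card_sdiff (Finset.subset_univ _), hcard]
    simp
  rw [hS]
  simp only [S, Finset.card_product, Finset.card_sigma]
  push_cast
  rw [Finset.sum_congr rfl hfib, Finset.sum_const, nsmul_eq_mul,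
    Finset.cast_card_sdiff (Finset.subset_univ _), Finset.cast_card_sdiff (Finset.subset_univ _),
    Finset.card_pair zero_ne_one, Finset.card_singleton, Finset.card_univ]
  push_cast
  ring
end

section
/- There is no 4×4 MDS matrix over the finite field with 4 elements, i.e., no 4×4 matrix over GF(4) in which every square submatrix is nonsingular. -/
/-- All entries of an MDS matrix are nonzero. -/
theorem IsMDS.apply_ne_zero {F : Type*} [Field F] {n : ℕ} {M : Matrix (Fin n) (Fin n) F}
    (hM : IsMDS M) (i j : Fin n) : M i j ≠ 0 := by
  simpa only [Matrix.det_fin_one, Matrix.submatrix_apply, Matrix.cons_val_zero] using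
    hM 1 le_rfl ![i] ![j] (Function.injective_of_subsingleton _)
      (Function.injective_of_subsingleton _)

/-- In an MDS matrix, the columnwise ratios of two distinct rows are pairwise distinct. -/
theorem IsMDS.injective_div {F : Type*} [Field F] {n : ℕ} {M : Matrix (Fin n) (Fin n) F}
    (hM : IsMDS M) {a b : Fin n} (hab : a ≠ b) :
    Function.Injective fun j => M b j / M a j := by
  intro i j hij
  by_contra hne
  have hinj {x y : Fin n} (hxy : x ≠ y) : Function.Injective ![x, y] :=
    injective_pair_iff_ne.mpr hxy
  refine hM 2 one_le_two ![a, b] ![i, j] (hinj hab) (hinj hne) ?_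
  have h := (div_eq_div_iff (hM.apply_ne_zero a i) (hM.apply_ne_zero a j)).mp hij
  simp only [Matrix.det_fin_two, Matrix.submatrix_apply, Matrix.cons_val_zero,
    Matrix.cons_val_one]
  linear_combination -h

/-- An MDS matrix of order at least two is smaller than its field. -/
theorem IsMDS.lt_card {F : Type*} [Field F] [Finite F] {n : ℕ} {M : Matrix (Fin n) (Fin n) F}
    (hM : IsMDS M) (hn : 2 ≤ n) : n < Nat.card F := by
  have hab : (⟨0, by lia⟩ : Fin n) ≠ ⟨1, hn⟩ := by simp
  have hinj : Function.Injective fun j => Units.mk0 _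
      (div_ne_zero (hM.apply_ne_zero ⟨1, hn⟩ j) (hM.apply_ne_zero ⟨0, by lia⟩ j)) :=
    fun i j hij => hM.injective_div hab (congrArg Units.val hij)
  have hle := Nat.card_le_card_of_injective _ hinj
  rw [Nat.card_fin, Nat.card_units] at hle
  have := Nat.card_pos (α := F)
  lia

theorem no_4x4_mds_over_gf4 :
    ¬ ∃ M : Matrix (Fin 4) (Fin 4) (GaloisField 2 2), IsMDS M := by
  rintro ⟨M, hM⟩
  have h := hM.lt_card (by norm_num)
  rw [GaloisField.card 2 2 two_ne_zero] at h
  norm_num at h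
end
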